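/- arXiv:2007.04661 — 4 statements merged into one kernel-verified Lean document; each statement's English description precedes it below -/
import Mathlib

section
/- Let Ω ⊂ ℝ² be a bounded open set with |Ω| > 0, let n ≥ 1, let p_1, …, p_n ∈ ℝ², and set r = (1/(4√π))·(|Ω|/n)^{1/2}. Then there exists a point p ∈ Ω such that p_j ∉ B(p, 2r) for every j = 1, …, n, and moreover |B(p, 2r) ∩ Ω| ≤ 34 · |B(p, r) ∩ Ω|. -/
open MeasureTheory Metric
open scoped ENNReal

/-- A continuous Caro–Wei inequality for bounded weights. -/
theorem setLIntegral_le_of_separated_of_bounded {α : Type*} [PseudoMetricSpace α]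
    [MeasurableSpace α] [OpensMeasurableSpace α] (μ : Measure α) {r : ℝ} (hr : 0 < r)
    {h : α → ℝ≥0∞} {N a : ℝ≥0∞} (hN : N ≠ ∞) (hbd : ∀ x, h x ≤ N) (ha : 1 < a) (k : ℕ)
    (S : Set α) (hS : ∀ x ∈ S, h x * μ (ball x r ∩ S) ≤ 1)
    (hk : ∀ T : Finset α, (∀ x ∈ T, x ∈ S) →
      (∀ x ∈ T, ∀ y ∈ T, x ≠ y → r ≤ dist x y) → T.card ≤ k) :
    ∫⁻ x in S, h x ∂μ ≤ k * a := by
  classical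
  induction k generalizing S with
  | zero =>
    have : S = ∅ := by
      by_contra hne
      obtain ⟨x, hx⟩ := Set.nonempty_iff_ne_empty.2 hne
      have := hk {x} (by simpa using hx) (by simp)
      simp at this
    simp [this]
  | succ k ih =>
    set s := ⨆ x ∈ S, h x with hs
    have hle : ∀ x ∈ S, h x ≤ s := fun x hx => le_iSup₂ (f := fun x _ => h x) x hx
    have hsN : s ≠ ∞ := ne_top_of_le_ne_top hN (iSup₂_le fun x _ => hbd x)
    by_cases hs0 : s = 0
    · calc ∫⁻ x in S, h x ∂μ ≤ ∫⁻ x in S, 0 ∂μ :=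
            setLIntegral_mono measurable_const fun x hx => (hle x hx).trans hs0.le
        _ ≤ _ := by simp
    · have hlt : s / a < s := by
        rw [ENNReal.div_lt_iff (Or.inl (by positivity)) (Or.inr hsN)]
        simpa using (ENNReal.mul_lt_mul_iff_right hs0 hsN).2 ha
      obtain ⟨v, hv⟩ := lt_iSup_iff.1 (hlt.trans_eq hs)
      obtain ⟨hvS, hv⟩ := lt_iSup_iff.1 hv
      have hsv : s ≤ h v * a :=
        ((ENNReal.div_lt_iff (Or.inl (by positivity)) (Or.inr hsN)).1 hv).le
      rw [← lintegral_inter_add_sdiff h S (measurableSet_ball (x := v) (ε := r))]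
      have h1 : ∫⁻ x in S ∩ ball v r, h x ∂μ ≤ a := by
        calc ∫⁻ x in S ∩ ball v r, h x ∂μ ≤ ∫⁻ x in S ∩ ball v r, h v * a ∂μ :=
              setLIntegral_mono measurable_const fun x hx => (hle x hx.1).trans hsv
          _ = (h v * μ (ball v r ∩ S)) * a := by
              rw [setLIntegral_const, Set.inter_comm]; ring
          _ ≤ 1 * a := by gcongr; exact hS v hvS
          _ = a := one_mul a
      have h2 : ∫⁻ x in S \ ball v r, h x ∂μ ≤ k * a := by
        refine ih _ (fun x hx => le_trans ?_ (hS x hx.1)) fun T hT hsep => ?_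
        · gcongr; exact Set.sdiff_subset
        · have hvT : v ∉ T := fun hvT => (hT v hvT).2 (mem_ball_self hr)
          have hd : ∀ x ∈ T, r ≤ dist x v := fun x hx => by simpa using (hT x hx).2
          have := hk (insert v T) ?_ ?_
          · rw [Finset.card_insert_of_notMem hvT] at this
            lia
          · simp only [Finset.mem_insert, forall_eq_or_imp]
            exact ⟨hvS, fun x hx => (hT x hx).1⟩
          · simp only [Finset.mem_insert, forall_eq_or_imp]
            refine ⟨⟨by simp, fun y hy _ => dist_comm y v ▸ hd y hy⟩, fun x hx => ⟨fun _ => hd x hx,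
              fun y hy => hsep x hx y hy⟩⟩
      calc _ ≤ a + k * a := add_le_add h1 h2
        _ = _ := by push_cast; ring

/-- A continuous Caro–Wei inequality: if `h x * μ (ball x r ∩ S) ≤ 1` on `S` and `r`-separated
subsets of `S` have at most `k` points, then the integral of `h` over `S` is at most `k`
(up to a factor arbitrarily close to one). -/
theorem setLIntegral_le_of_separated {α : Type*} [PseudoMetricSpace α]
    [MeasurableSpace α] [OpensMeasurableSpace α] (μ : Measure α) {r : ℝ} (hr : 0 < r)
    {h : α → ℝ≥0∞} (hm : Measurable h) {a : ℝ≥0∞} (ha : 1 < a) (k : ℕ)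
    (S : Set α) (hS : ∀ x ∈ S, h x * μ (ball x r ∩ S) ≤ 1)
    (hk : ∀ T : Finset α, (∀ x ∈ T, x ∈ S) →
      (∀ x ∈ T, ∀ y ∈ T, x ≠ y → r ≤ dist x y) → T.card ≤ k) :
    ∫⁻ x in S, h x ∂μ ≤ k * a := by
  have hsup : ∀ x, h x = ⨆ N : ℕ, min (h x) N := fun x => by
    rw [← inf_iSup_eq, ENNReal.iSup_natCast, inf_top_eq]
  rw [lintegral_congr hsup]
  rw [lintegral_iSup (fun N => hm.min measurable_const)
    (fun M N hMN x => min_le_min le_rfl (by exact_mod_cast hMN))]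
  refine iSup_le fun N => setLIntegral_le_of_separated_of_bounded μ hr (ENNReal.natCast_ne_top N)
    (fun x => min_le_right _ _) ha k S (fun x hx => le_trans ?_ (hS x hx)) hk
  gcongr
  exact min_le_left _ _

/-- An `r`-separated set in a ball of radius `2 * r` of a `d`-dimensional normed space has at most
`5 ^ d` points. -/
theorem card_le_of_separated_ball {E : Type*} [NormedAddCommGroup E] [NormedSpace ℝ E]
    [FiniteDimensional ℝ E] {r : ℝ} (hr : 0 < r) (y : E) (T : Finset E)
    (hT : ∀ x ∈ T, x ∈ ball y (2 * r))
    (hsep : ∀ x ∈ T, ∀ z ∈ T, x ≠ z → r ≤ dist x z) :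
    T.card ≤ 5 ^ Module.finrank ℝ E := by
  classical
  have hinj : Function.Injective fun x : E => r⁻¹ • (x - y) := fun x z hxz => by
    simpa [hr.ne'] using hxz
  rw [← Finset.card_image_of_injective T hinj]
  refine Besicovitch.card_le_of_separated _ ?_ ?_
  · simp only [Finset.forall_mem_image]
    intro x hx
    have := hT x hx
    rw [mem_ball, dist_eq_norm] at this
    rw [norm_smul, norm_inv, Real.norm_of_nonneg hr.le, inv_mul_le_iff₀ hr]
    linarith
  · simp only [Finset.forall_mem_image]
    intro x hx z hz hne
    have := hsep x hx z hz fun h => hne (by rw [h])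
    rw [dist_eq_norm] at this
    rw [← smul_sub, sub_sub_sub_cancel_right, norm_smul, norm_inv, Real.norm_of_nonneg hr.le,
      le_inv_mul_iff₀ hr]
    linarith

/-- Lemma "ball": for a bounded open set `Ω ⊂ ℝ²` of positive area, points `p 1, …, p n`
(`n ≥ 1`) and `r = (1/(4√π))·(|Ω|/n)^{1/2}`, there exists a point `c ∈ Ω` such that no `p j`
lies in `B(c, 2r)` and moreover `|B(c, 2r) ∩ Ω| ≤ 34 |B(c, r) ∩ Ω|`. -/
theorem stmt_4 (Ω : Set (EuclideanSpace ℝ (Fin 2))) (hΩ : IsOpen Ω)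
    (hbd : Bornology.IsBounded Ω) (h0 : 0 < volume Ω) (n : ℕ) (hn : 1 ≤ n)
    (p : Fin n → EuclideanSpace ℝ (Fin 2)) (r : ℝ)
    (hr : r = (1 / (4 * Real.sqrt Real.pi)) * Real.sqrt ((volume Ω).toReal / n)) :
    ∃ c ∈ Ω, (∀ j, p j ∉ Metric.ball c (2 * r)) ∧
      volume (Metric.ball c (2 * r) ∩ Ω) ≤ 34 * volume (Metric.ball c r ∩ Ω) := by
  by_contra! hcon
  have hfin : volume Ω ≠ ∞ := hbd.measure_lt_top.ne
  have hV : 0 < (volume Ω).toReal := ENNReal.toReal_pos h0.ne' hfin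
  have hn0 : (0 : ℝ) < n := by exact_mod_cast hn
  have hr0 : 0 < r := by rw [hr]; positivity
  have hr2 : n * ((2 * r) ^ 2 * Real.pi) = (volume Ω).toReal / 4 := by
    rw [hr, mul_pow, mul_pow, div_pow, mul_pow, Real.sq_sqrt Real.pi_pos.le,
      Real.sq_sqrt (by positivity)]
    field_simp
    norm_num
  set U := ⋃ j, ball (p j) (2 * r) with hU
  set G := Ω \ U with hG
  have hGm : MeasurableSet G :=
    hΩ.measurableSet.diff (isOpen_iUnion fun _ => isOpen_ball).measurableSet
  have hGfin : volume G ≠ ∞ := ne_top_of_le_ne_top hfin (measure_mono Set.sdiff_subset)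
  have hUV : volume U ≤ ENNReal.ofReal ((volume Ω).toReal / 4) := by
    refine (measure_iUnion_le _).trans ?_
    simp only [EuclideanSpace.volume_ball_fin_two, tsum_fintype, Finset.sum_const,
      Finset.card_univ, Fintype.card_fin, nsmul_eq_mul]
    rw [← hr2, ENNReal.ofReal_mul hn0.le, ENNReal.ofReal_natCast,
      ENNReal.ofReal_mul (p := (2 * r) ^ 2) (by positivity), ENNReal.ofReal_pow (by positivity)]
  have hGV : (volume Ω).toReal ≤ (volume G).toReal + (volume Ω).toReal / 4 := by
    have h1 : volume Ω ≤ volume G + ENNReal.ofReal ((volume Ω).toReal / 4) := by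
      refine le_trans ?_ (add_le_add_right hUV _)
      refine (measure_mono ?_).trans (measure_union_le G U)
      rw [hG, Set.sdiff_union_self]
      exact Set.subset_union_left
    have h2 := ENNReal.toReal_mono (by finiteness) h1
    rwa [ENNReal.toReal_add hGfin (by finiteness), ENNReal.toReal_ofReal (by positivity)] at h2
  have hmeas : ∀ s : ℝ, Measurable fun c : EuclideanSpace ℝ (Fin 2) => volume (ball c s ∩ Ω) := by
    intro s
    have : MeasurableSet {q : EuclideanSpace ℝ (Fin 2) × EuclideanSpace ℝ (Fin 2) |
        dist q.2 q.1 < s} := (isOpen_lt (by fun_prop) (by fun_prop)).measurableSet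
    have := measurable_measure_prodMk_left (ν := volume.restrict Ω) this
    convert this using 2 with c
    exact (Measure.restrict_apply measurableSet_ball).symm
  set h : EuclideanSpace ℝ (Fin 2) → ℝ≥0∞ := fun c => (volume (ball c r ∩ Ω))⁻¹ with hh
  have hhm : Measurable h := (hmeas r).inv
  set a : ℝ≥0∞ := ENNReal.ofReal (101 / 100) with ha
  have ha1 : 1 < a := by simp [ha]; norm_num
  have hupper : ∀ y, ∫⁻ c in G ∩ ball y (2 * r), h c ≤ 25 * a := by
    intro y
    refine setLIntegral_le_of_separated volume hr0 hhm ha1 25 _ (fun x hx => ?_)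
      fun T hT hsep => ?_
    · refine le_trans ?_ (ENNReal.inv_mul_le_one (volume (ball x r ∩ Ω)))
      gcongr
      exact Set.inter_subset_left.trans Set.sdiff_subset
    · simpa using card_le_of_separated_ball hr0 y T (fun x hx => (hT x hx).2) hsep
  have hswap : ∫⁻ c in G, volume (ball c (2 * r) ∩ Ω) * h c
      = ∫⁻ y in Ω, ∫⁻ c in G ∩ ball y (2 * r), h c := by
    have hF : Measurable (Function.uncurry fun c y : EuclideanSpace ℝ (Fin 2) =>
        (ball c (2 * r)).indicator (fun _ => h c) y) := by
      have : MeasurableSet {q : EuclideanSpace ℝ (Fin 2) × EuclideanSpace ℝ (Fin 2) |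
          dist q.2 q.1 < 2 * r} := (isOpen_lt (by fun_prop) (by fun_prop)).measurableSet
      exact (hhm.comp measurable_fst).indicator this
    calc ∫⁻ c in G, volume (ball c (2 * r) ∩ Ω) * h c
        = ∫⁻ c in G, ∫⁻ y in Ω, (ball c (2 * r)).indicator (fun _ => h c) y := by
          refine lintegral_congr fun c => ?_
          rw [lintegral_indicator_const measurableSet_ball,
            Measure.restrict_apply measurableSet_ball, mul_comm]
      _ = ∫⁻ y in Ω, ∫⁻ c in G, (ball c (2 * r)).indicator (fun _ => h c) y :=
          lintegral_lintegral_swap hF.aemeasurable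
      _ = ∫⁻ y in Ω, ∫⁻ c in G ∩ ball y (2 * r), h c := by
          refine lintegral_congr fun y => ?_
          rw [Set.inter_comm, ← Measure.restrict_restrict measurableSet_ball,
            ← lintegral_indicator measurableSet_ball]
          refine lintegral_congr fun c => ?_
          classical
          simp only [Set.indicator_apply, mem_ball_comm (x := y)]
  have hlower : 34 * volume G ≤ ∫⁻ c in G, volume (ball c (2 * r) ∩ Ω) * h c := by
    rw [← setLIntegral_const]
    refine setLIntegral_mono' hGm fun c hc => ?_
    have hpos : volume (ball c r ∩ Ω) ≠ 0 :=
      ((isOpen_ball.inter hΩ).measure_pos volume ⟨c, mem_ball_self hr0, hc.1⟩).ne'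
    have hft : volume (ball c r ∩ Ω) ≠ ∞ :=
      ne_top_of_le_ne_top hfin (measure_mono Set.inter_subset_right)
    have := hcon c hc.1 fun j hj => hc.2 (Set.mem_iUnion.2 ⟨j, mem_ball_comm.1 hj⟩)
    rw [hh, ← div_eq_mul_inv, ENNReal.le_div_iff_mul_le (Or.inl hpos) (Or.inl hft)]
    exact this.le
  have hfinal : 34 * volume G ≤ 25 * a * volume Ω := by
    rw [← setLIntegral_const Ω]
    exact hlower.trans (hswap.le.trans (setLIntegral_mono measurable_const fun y _ => hupper y))
  have h3 := ENNReal.toReal_mono (by finiteness) hfinal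
  simp only [ENNReal.toReal_mul, ha, ENNReal.toReal_ofReal (show (0 : ℝ) ≤ 101 / 100 by norm_num),
    ENNReal.toReal_ofNat] at h3
  linarith
end

section
/- Let Ω ⊂ ℝ² be a bounded open set with |Ω| > 0, let n ≥ 1, let p_1, …, p_n ∈ ℝ² and Φ_1, …, Φ_n ∈ ℝ, and define the Aharonov–Bohm vector potential A(x) = ∑_{i=1}^n (Φ_i/‖x − p_i‖²)·(−(x − p_i)_2, (x − p_i)_1) for x ∈ ℝ² \ {p_1, …, p_n}. Then there exists a Lipschitz function u : ℝ² → ℂ, vanishing on a neighborhood of each point p_j, such that ∫_Ω |u|² > 0 and ∫_Ω ‖Du(x) − i u(x) A(x)‖² dx ≤ 544π (n/|Ω|) ∫_Ω |u|² dx, where Du denotes the (almost everywhere defined) derivative of u, viewed as a vector in ℂ², and A(x) ∈ ℝ² ⊂ ℂ². -/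
open MeasureTheory Metric

/-- The Aharonov–Bohm potential with poles `p j` and fluxes `Φ j`:
`A(x) = ∑ⱼ (Φ j/‖x − p j‖²)·(−(x − p j)₂, (x − p j)₁)`, written componentwise. -/
noncomputable def abPotential (n : ℕ) (p : Fin n → EuclideanSpace ℝ (Fin 2))
    (Φ : Fin n → ℝ) (x : EuclideanSpace ℝ (Fin 2)) (i : Fin 2) : ℝ :=
  ∑ j, (Φ j / ‖x - p j‖ ^ 2) * (if i = 0 then -((x - p j) 1) else (x - p j) 0)

local notation "ℝ²" => EuclideanSpace ℝ (Fin 2)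

/-- Tonelli: the average over all centers of the area of `s` in a disk of fixed radius. -/
lemma lintegral_volume_inter_closedBall {s : Set ℝ²} (hs : MeasurableSet s) (r : ℝ) :
    ∫⁻ x, volume (s ∩ closedBall x r) = volume (closedBall (0 : ℝ²) r) * volume s := by
  have hT : MeasurableSet {z : ℝ² × ℝ² | z.2 ∈ s ∧ dist z.2 z.1 ≤ r} :=
    (measurable_snd hs).inter
      (isClosed_le (continuous_snd.dist continuous_fst) continuous_const).measurableSet
  have h := (Measure.prod_apply (μ := volume) (ν := volume) hT).symm.trans
    (Measure.prod_apply_symm hT)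
  refine h.trans ?_
  have hsec : ∀ y : ℝ², volume ((fun x => (x, y)) ⁻¹' {z : ℝ² × ℝ² | z.2 ∈ s ∧ dist z.2 z.1 ≤ r})
      = s.indicator (fun _ => volume (closedBall (0 : ℝ²) r)) y := by
    intro y
    by_cases hy : y ∈ s
    · rw [Set.indicator_of_mem hy, Measure.addHaar_closedBall_center volume (0 : ℝ²) r,
        ← Measure.addHaar_closedBall_center volume y r]
      congr 1
      ext x
      simp [hy, dist_comm y x]
    · simp [hy]
  simp_rw [hsec]
  rw [lintegral_indicator hs, setLIntegral_const]

/-- If the disks of radius `2r` around the `n` points `p j` have total area at most half of that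
of `s`, some disk centered at distance at least `2r` from all of them satisfies a doubling bound
for the area of `s`. -/
lemma exists_center_doubling {s : Set ℝ²} (hs : MeasurableSet s) (h0 : volume s ≠ 0)
    (hfin : volume s ≠ ⊤) {n : ℕ} (p : Fin n → ℝ²) {r : ℝ} (hr : 0 < r)
    (harea : 8 * Real.pi * n * r ^ 2 ≤ (volume s).toReal) :
    ∃ x, (∀ j, 2 * r ≤ dist x (p j)) ∧
      volume (s ∩ closedBall x r) < 9 * volume (s ∩ closedBall x (r / 2)) := by
  by_contra! hcon
  set B : Set ℝ² := ⋃ j, ball (p j) (2 * r) with hB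
  have hBm : MeasurableSet B := MeasurableSet.iUnion fun j => measurableSet_ball
  have hV : volume (closedBall (0 : ℝ²) r) = ENNReal.ofReal (r ^ 2 * Real.pi) := by
    rw [EuclideanSpace.volume_closedBall_fin_two, ENNReal.ofReal_mul (by positivity),
      ENNReal.ofReal_pow hr.le]
  have hV' : volume (closedBall (0 : ℝ²) (r / 2)) = ENNReal.ofReal ((r / 2) ^ 2 * Real.pi) := by
    rw [EuclideanSpace.volume_closedBall_fin_two, ENNReal.ofReal_mul (by positivity),
      ENNReal.ofReal_pow (by positivity)]
  have hBvol : volume B ≤ ENNReal.ofReal ((volume s).toReal / 2) := by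
    calc volume B ≤ ∑ j, volume (ball (p j) (2 * r)) := measure_iUnion_fintype_le _ _
      _ = ENNReal.ofReal (n * ((2 * r) ^ 2 * Real.pi)) := by
        simp_rw [EuclideanSpace.volume_ball_fin_two]
        rw [Finset.sum_const, Finset.card_univ, Fintype.card_fin, nsmul_eq_mul,
          ENNReal.ofReal_mul n.cast_nonneg, ENNReal.ofReal_natCast,
          ENNReal.ofReal_mul (p := (2 * r) ^ 2) (by positivity),
          ENNReal.ofReal_pow (by positivity)]
      _ ≤ _ := ENNReal.ofReal_le_ofReal (by linarith)
  have hgood : 9 * ∫⁻ x in Bᶜ, volume (s ∩ closedBall x (r / 2))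
      ≤ volume (closedBall (0 : ℝ²) r) * volume s := by
    rw [← lintegral_volume_inter_closedBall hs r, ← lintegral_const_mul' _ _ (by simp)]
    refine (setLIntegral_mono' hBm.compl fun x hx => hcon x fun j => ?_).trans
      (setLIntegral_le_lintegral _ _)
    by_contra! hlt
    exact hx (Set.mem_iUnion.2 ⟨j, hlt⟩)
  have hbad : ∫⁻ x in B, volume (s ∩ closedBall x (r / 2))
      ≤ volume (closedBall (0 : ℝ²) (r / 2)) * volume B := by
    rw [← setLIntegral_const]
    refine lintegral_mono fun x => (measure_mono Set.inter_subset_right).trans ?_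
    rw [Measure.addHaar_closedBall_center volume x]
  have htot : 9 * (volume (closedBall (0 : ℝ²) (r / 2)) * volume s)
      ≤ 9 * (volume (closedBall (0 : ℝ²) (r / 2)) * volume B)
        + volume (closedBall (0 : ℝ²) r) * volume s := by
    rw [← lintegral_volume_inter_closedBall hs (r / 2), ← lintegral_add_compl _ hBm, mul_add]
    gcongr
  have htot' := htot.trans (add_le_add_left (mul_le_mul_right (mul_le_mul_right hBvol _) _) _)
  have ha : 0 < (volume s).toReal := ENNReal.toReal_pos h0 hfin
  rw [hV, hV', ← ENNReal.ofReal_toReal hfin, ENNReal.toReal_ofReal ha.le,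
    show (9 : ENNReal) = ENNReal.ofReal 9 by simp,
    ← ENNReal.ofReal_mul (by positivity), ← ENNReal.ofReal_mul (by positivity),
    ← ENNReal.ofReal_mul (by positivity), ← ENNReal.ofReal_mul (by positivity),
    ← ENNReal.ofReal_mul (by positivity),
    ← ENNReal.ofReal_add (by positivity) (by positivity),
    ENNReal.ofReal_le_ofReal_iff (by positivity)] at htot'
  have : 0 < r ^ 2 * Real.pi * (volume s).toReal := by positivity
  nlinarith

/-- The identification `ℝ² ≃ ℂ`. -/
noncomputable def toComplex : ℝ² ≃ₗᵢ[ℝ] ℂ := Complex.orthonormalBasisOneI.repr.symm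

lemma toComplex_re (v : ℝ²) : (toComplex v).re = v 0 := by
  simp [toComplex, Complex.orthonormalBasisOneI_repr_symm_apply]

lemma toComplex_im (v : ℝ²) : (toComplex v).im = v 1 := by
  simp [toComplex, Complex.orthonormalBasisOneI_repr_symm_apply]

/-- A branch near `x₀` of the angle of `x - q`. -/
noncomputable def branchAngle (x₀ q x : ℝ²) : ℝ :=
  (Complex.log (toComplex (x - q) / toComplex (x₀ - q))).im

lemma toComplex_sub_div_mem_slitPlane {x₀ q x : ℝ²} (h : dist x x₀ < dist x₀ q) :
    toComplex (x - q) / toComplex (x₀ - q) ∈ Complex.slitPlane := by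
  have hpos : 0 < ‖x₀ - q‖ := by
    rw [← dist_eq_norm]; exact dist_nonneg.trans_lt h
  have hne : toComplex (x₀ - q) ≠ 0 := by
    rw [← norm_pos_iff, LinearIsometryEquiv.norm_map]; exact hpos
  have heq : toComplex (x - q) / toComplex (x₀ - q)
      = 1 + toComplex (x - x₀) / toComplex (x₀ - q) := by
    rw [div_eq_iff hne, add_mul, div_mul_cancel₀ _ hne, one_mul, ← map_add]
    congr 1
    abel
  rw [heq]
  apply Complex.mem_slitPlane_of_norm_lt_one
  rw [norm_div, LinearIsometryEquiv.norm_map, LinearIsometryEquiv.norm_map, div_lt_one hpos,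
    ← dist_eq_norm, ← dist_eq_norm]
  exact h

lemma contDiffAt_branchAngle {x₀ q x : ℝ²} (h : dist x x₀ < dist x₀ q) :
    ContDiffAt ℝ 1 (branchAngle x₀ q) x := by
  have h1 : ContDiffAt ℝ 1 (fun y : ℝ² => toComplex (y - q) / toComplex (x₀ - q)) x := by
    refine ContDiffAt.div_const ?_ _
    exact toComplex.contDiff.contDiffAt.comp x (contDiffAt_id.sub contDiffAt_const)
  exact Complex.imCLM.contDiff.contDiffAt.comp x
    (((Complex.contDiffAt_log (toComplex_sub_div_mem_slitPlane h)).restrict_scalars ℝ).comp x h1)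

lemma fderiv_branchAngle {x₀ q x : ℝ²} (h : dist x x₀ < dist x₀ q) (i : Fin 2) :
    fderiv ℝ (branchAngle x₀ q) x (EuclideanSpace.single i 1)
      = 1 / ‖x - q‖ ^ 2 * (if i = 0 then -((x - q) 1) else (x - q) 0) := by
  have hmem := toComplex_sub_div_mem_slitPlane h
  have hnum : toComplex (x - q) ≠ 0 := fun h0 =>
    Complex.slitPlane_ne_zero hmem (by rw [h0, zero_div])
  have hden : toComplex (x₀ - q) ≠ 0 := fun h0 =>
    Complex.slitPlane_ne_zero hmem (by rw [h0, div_zero])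
  have h1 : HasFDerivAt (fun y : ℝ² => toComplex (y - q) / toComplex (x₀ - q))
      ((toComplex (x₀ - q))⁻¹ • (toComplex.toContinuousLinearEquiv : ℝ² →L[ℝ] ℂ)) x := by
    simp_rw [div_eq_mul_inv]
    exact ((toComplex.toContinuousLinearEquiv : ℝ² →L[ℝ] ℂ).hasFDerivAt.comp x
      ((hasFDerivAt_id x).sub_const q)).mul_const _
  have h2 := (Complex.hasStrictFDerivAt_log_real hmem).hasFDerivAt.comp x h1
  have h3 : HasFDerivAt (branchAngle x₀ q) _ x := Complex.imCLM.hasFDerivAt.comp x h2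
  have hnorm : ‖x - q‖ ^ 2 = Complex.normSq (toComplex (x - q)) := by
    rw [Complex.normSq_eq_norm_sq, LinearIsometryEquiv.norm_map]
  have hval : ∀ w : ℂ, (toComplex (x - q) / toComplex (x₀ - q))⁻¹ * ((toComplex (x₀ - q))⁻¹ * w)
      = w / toComplex (x - q) := by
    intro w; field_simp
  have hL : fderiv ℝ (branchAngle x₀ q) x (EuclideanSpace.single i 1)
      = (toComplex (EuclideanSpace.single i 1) / toComplex (x - q)).im := by
    rw [h3.fderiv, ← hval]
    simp [smul_eq_mul]
  rw [hL, hnorm, Complex.div_im]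
  fin_cases i <;> simp [toComplex_re, toComplex_im] <;> ring

/-- The Aharonov–Bohm potential is a gradient on any disk containing no pole. -/
lemma exists_phase_of_forall_le_dist {n : ℕ} (p : Fin n → ℝ²) (Φ : Fin n → ℝ) {x₀ : ℝ²} {R : ℝ}
    (hR : ∀ j, R ≤ dist x₀ (p j)) :
    ∃ θ : ℝ² → ℝ, (∀ x ∈ ball x₀ R, ContDiffAt ℝ 1 θ x) ∧
      ∀ x ∈ ball x₀ R, ∀ i, fderiv ℝ θ x (EuclideanSpace.single i 1) = abPotential n p Φ x i := by
  have hlt : ∀ x ∈ ball x₀ R, ∀ j, dist x x₀ < dist x₀ (p j) := fun x hx j =>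
    (mem_ball.1 hx).trans_le (hR j)
  refine ⟨fun x => ∑ j, Φ j * branchAngle x₀ (p j) x, fun x hx => ?_, fun x hx i => ?_⟩
  · exact ContDiffAt.sum fun j _ => contDiffAt_const.mul (contDiffAt_branchAngle (hlt x hx j))
  · have hd : ∀ j, DifferentiableAt ℝ (branchAngle x₀ (p j)) x := fun j =>
      (contDiffAt_branchAngle (hlt x hx j)).differentiableAt (by simp)
    rw [fderiv_fun_sum fun j _ => (hd j).const_mul _, _root_.sum_apply, abPotential]
    refine Finset.sum_congr rfl fun j _ => ?_
    rw [fderiv_const_mul (hd j), _root_.smul_apply, fderiv_branchAngle (hlt x hx j),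
      smul_eq_mul]
    ring

/-- The tent of height `1` on the disk of radius `r` around `x₀`. -/
noncomputable def tent (x₀ : ℝ²) (r : ℝ) (x : ℝ²) : ℝ := max (1 - dist x x₀ / r) 0

lemma tent_nonneg (x₀ : ℝ²) (r : ℝ) (x : ℝ²) : 0 ≤ tent x₀ r x := le_max_right _ _

lemma tent_le_one (x₀ x : ℝ²) {r : ℝ} (hr : 0 < r) : tent x₀ r x ≤ 1 :=
  max_le (sub_le_self _ (by positivity)) zero_le_one

lemma tent_eq_zero {x₀ x : ℝ²} {r : ℝ} (hr : 0 < r) (h : r ≤ dist x x₀) : tent x₀ r x = 0 :=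
  max_eq_right (sub_nonpos.2 ((one_le_div hr).2 h))

lemma half_le_tent {x₀ x : ℝ²} {r : ℝ} (hr : 0 < r) (h : dist x x₀ ≤ r / 2) :
    1 / 2 ≤ tent x₀ r x := by
  refine le_max_of_le_left ?_
  have : dist x x₀ / r ≤ 1 / 2 := by rw [div_le_iff₀ hr]; linarith
  linarith

lemma lipschitzWith_tent (x₀ : ℝ²) {r : ℝ} (hr : 0 < r) :
    LipschitzWith (1 / r).toNNReal (tent x₀ r) := by
  refine LipschitzWith.max_const (LipschitzWith.of_dist_le_mul fun x y => ?_) 0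
  rw [Real.coe_toNNReal _ (by positivity), Real.dist_eq,
    show 1 - dist x x₀ / r - (1 - dist y x₀ / r) = 1 / r * (dist y x₀ - dist x x₀) by ring,
    abs_mul, abs_of_pos (by positivity)]
  gcongr
  rw [dist_comm x y]
  exact abs_dist_sub_le y x x₀

lemma sum_sq_apply_single_le (L : ℝ² →L[ℝ] ℝ) :
    ∑ i, L (EuclideanSpace.single i 1) ^ 2 ≤ ‖L‖ ^ 2 := by
  set v := (InnerProductSpace.toDual ℝ ℝ²).symm L with hv
  have hL : ∀ i, L (EuclideanSpace.single i 1) = v i := by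
    intro i
    rw [← InnerProductSpace.toDual_symm_apply, ← hv]
    simp [EuclideanSpace.inner_single_right]
  have hn : ‖L‖ = ‖v‖ := by rw [hv, LinearIsometryEquiv.norm_map]
  rw [hn, EuclideanSpace.norm_sq_eq]
  simp [hL]

/-- The product of the tent function on a disk with a phase `exp (iθ)`, where `θ` is `C¹` on the
concentric disk of twice the radius, is Lipschitz. -/
lemma exists_lipschitzWith_tent_mul_exp {x₀ : ℝ²} {r : ℝ} (hr : 0 < r) {θ : ℝ² → ℝ}
    (hθ : ∀ x ∈ ball x₀ (2 * r), ContDiffAt ℝ 1 θ x) :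
    ∃ K, LipschitzWith K fun x => (tent x₀ r x : ℂ) * Complex.exp (θ x * Complex.I) := by
  let χ : ContDiffBump x₀ := ⟨r, 3 / 2 * r, hr, by linarith⟩
  set g : ℝ² → ℂ := fun x => (χ x : ℂ) * Complex.exp (θ x * Complex.I) with hg
  have hgsupp : HasCompactSupport g := by
    refine χ.hasCompactSupport.mono fun x hx => ?_
    contrapose! hx
    simp [hg, Function.notMem_support.1 hx]
  have hgdiff : ContDiff ℝ 1 g := by
    rw [contDiff_iff_contDiffAt]
    intro x
    by_cases hx : x ∈ ball x₀ (2 * r)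
    · refine (Complex.ofRealCLM.contDiff.contDiffAt.comp x χ.contDiffAt).mul ?_
      exact ((Complex.ofRealCLM.contDiff.contDiffAt.comp x (hθ x hx)).mul contDiffAt_const).cexp
    · have hx' : x ∉ tsupport χ := by
        rw [χ.tsupport_eq]
        intro h
        have h1 : dist x x₀ ≤ 3 / 2 * r := h
        exact hx (mem_ball.2 (by linarith))
      have hev : g =ᶠ[nhds x] fun _ => 0 := by
        filter_upwards [(isClosed_tsupport χ).isOpen_compl.mem_nhds hx'] with y hy
        simp [hg, image_eq_zero_of_notMem_tsupport hy]
      exact contDiffAt_const.congr_of_eventuallyEq hev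
  obtain ⟨C, hC⟩ := hgdiff.lipschitzWith_of_hasCompactSupport hgsupp one_ne_zero
  have heq : (fun x => (tent x₀ r x : ℂ) * Complex.exp (θ x * Complex.I))
      = fun x => (tent x₀ r x : ℂ) * g x := by
    funext x
    rcases le_total r (dist x x₀) with h | h
    · simp [tent_eq_zero hr h]
    · simp [hg, χ.one_of_mem_closedBall (mem_closedBall.2 h)]
  have hg1 : ∀ x, ‖g x‖ ≤ 1 := by
    intro x
    rw [hg, norm_mul, Complex.norm_exp_ofReal_mul_I, mul_one, Complex.norm_real,
      Real.norm_of_nonneg χ.nonneg]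
    exact χ.le_one
  rw [heq]
  refine ⟨(1 / r).toNNReal + C, LipschitzWith.of_dist_le_mul fun x y => ?_⟩
  have h1 := (lipschitzWith_tent x₀ hr).dist_le_mul x y
  have h2 := hC.dist_le_mul x y
  rw [Real.dist_eq] at h1
  rw [dist_eq_norm] at h2 ⊢
  calc ‖(tent x₀ r x : ℂ) * g x - tent x₀ r y * g y‖
      = ‖((tent x₀ r x - tent x₀ r y : ℝ) : ℂ) * g x + tent x₀ r y * (g x - g y)‖ := by
        congr 1; push_cast; ring
    _ ≤ |tent x₀ r x - tent x₀ r y| * ‖g x‖ + |tent x₀ r y| * ‖g x - g y‖ := by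
        refine (norm_add_le _ _).trans_eq ?_
        rw [norm_mul _ (g x), norm_mul _ (g x - g y), Complex.norm_real, Complex.norm_real,
          Real.norm_eq_abs, Real.norm_eq_abs]
    _ ≤ |tent x₀ r x - tent x₀ r y| * 1 + 1 * ‖g x - g y‖ := by
        gcongr
        · exact hg1 x
        · rw [abs_of_nonneg (tent_nonneg _ _ _)]
          exact tent_le_one _ _ hr
    _ ≤ ((1 / r).toNNReal * dist x y) * 1 + 1 * (C * dist x y) := by gcongr
    _ = _ := by push_cast; ring

/-- Gauge invariance: if `A` is the gradient of `θ`, the covariant gradient of `f exp(iθ)` has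
the same length as the gradient of `f`. -/
lemma norm_fderiv_mul_exp_sub {f θ : ℝ² → ℝ} {x : ℝ²} (hf : DifferentiableAt ℝ f x)
    (hθ : DifferentiableAt ℝ θ x) (v : ℝ²) :
    ‖fderiv ℝ (fun y => (f y : ℂ) * Complex.exp (θ y * Complex.I)) x v
      - Complex.I * (f x * Complex.exp (θ x * Complex.I)) * (fderiv ℝ θ x v : ℂ)‖
      = |fderiv ℝ f x v| := by
  have h1 : HasFDerivAt (fun y => (f y : ℂ)) (Complex.ofRealCLM.comp (fderiv ℝ f x)) x :=
    Complex.ofRealCLM.hasFDerivAt.comp x hf.hasFDerivAt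
  have h2 : HasFDerivAt (fun y => (θ y : ℂ)) (Complex.ofRealCLM.comp (fderiv ℝ θ x)) x :=
    Complex.ofRealCLM.hasFDerivAt.comp x hθ.hasFDerivAt
  have h3 := h1.fun_mul (h2.mul_const Complex.I).cexp
  have h4 : fderiv ℝ (fun y => (f y : ℂ) * Complex.exp (θ y * Complex.I)) x v
      - Complex.I * (f x * Complex.exp (θ x * Complex.I)) * (fderiv ℝ θ x v : ℂ)
      = (fderiv ℝ f x v : ℂ) * Complex.exp (θ x * Complex.I) := by
    rw [h3.fderiv]
    simp [smul_eq_mul]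
    ring
  rw [h4, norm_mul, Complex.norm_exp_ofReal_mul_I, mul_one, Complex.norm_real, Real.norm_eq_abs]

/-- Theorem 2.1 (analytic content): for a bounded open `Ω ⊂ ℝ²` of positive area and the
Aharonov–Bohm potential `A` with poles `p 1, …, p n` (`n ≥ 1`), there is a Lipschitz test
function `u : ℝ² → ℂ`, vanishing on a neighborhood of each pole, with
`∫_Ω |∇ᴬu|² ≤ 544π (n/|Ω|) ∫_Ω |u|²` and `∫_Ω |u|² > 0`;
here `∇ᴬu(x) = Du(x) − i u(x) A(x) ∈ ℂ²` componentwise. -/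
theorem stmt_5 (Ω : Set (EuclideanSpace ℝ (Fin 2))) (hΩ : IsOpen Ω)
    (hbd : Bornology.IsBounded Ω) (h0 : 0 < volume Ω) (n : ℕ) (hn : 1 ≤ n)
    (p : Fin n → EuclideanSpace ℝ (Fin 2)) (Φ : Fin n → ℝ) :
    ∃ u : EuclideanSpace ℝ (Fin 2) → ℂ,
      (∃ K : NNReal, LipschitzWith K u) ∧
      (∀ j, ∃ ε > 0, ∀ x ∈ Metric.ball (p j) ε, u x = 0) ∧
      (0 < ∫ x in Ω, ‖u x‖ ^ 2) ∧
      (∫ x in Ω, ∑ i : Fin 2,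
          ‖fderiv ℝ u x (EuclideanSpace.single i 1)
            - Complex.I * u x * (abPotential n p Φ x i : ℂ)‖ ^ 2)
        ≤ 544 * Real.pi * ((n : ℝ) / (volume Ω).toReal) * ∫ x in Ω, ‖u x‖ ^ 2 := by
  have hfin : volume Ω ≠ ⊤ := hbd.measure_lt_top.ne
  set V := (volume Ω).toReal with hV
  have hVpos : 0 < V := ENNReal.toReal_pos h0.ne' hfin
  have hn' : (0 : ℝ) < n := by exact_mod_cast hn
  have hpi := Real.pi_pos
  set r := √(V / (8 * Real.pi * n)) with hrdef
  have hr : 0 < r := Real.sqrt_pos.2 (by positivity)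
  have hr2 : r ^ 2 = V / (8 * Real.pi * n) := Real.sq_sqrt (by positivity)
  obtain ⟨x₀, hfar, hdoub⟩ := exists_center_doubling hΩ.measurableSet h0.ne' hfin p hr
    (by rw [hr2, mul_div_cancel₀ _ (by positivity)])
  obtain ⟨θ, hθ, hgrad⟩ := exists_phase_of_forall_le_dist p Φ hfar
  obtain ⟨K, hK⟩ := exists_lipschitzWith_tent_mul_exp hr hθ
  set u : EuclideanSpace ℝ (Fin 2) → ℂ :=
    fun x => (tent x₀ r x : ℂ) * Complex.exp (θ x * Complex.I) with hu
  have hnorm : ∀ x, ‖u x‖ = tent x₀ r x := fun x => by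
    rw [hu, norm_mul, Complex.norm_exp_ofReal_mul_I, mul_one, Complex.norm_real,
      Real.norm_of_nonneg (tent_nonneg _ _ _)]
  have : IsFiniteMeasure (volume.restrict Ω) := isFiniteMeasure_restrict.2 hfin
  have hconst : ∀ (ρ c : ℝ), ∫ x in Ω, (closedBall x₀ ρ).indicator (fun _ => c) x
      = c * (volume (Ω ∩ closedBall x₀ ρ)).toReal := fun ρ c => by
    rw [integral_indicator measurableSet_closedBall, Measure.restrict_restrict
      measurableSet_closedBall, setIntegral_const, smul_eq_mul, mul_comm, Set.inter_comm]
    rfl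
  have hconsti : ∀ (ρ c : ℝ), Integrable ((closedBall x₀ ρ).indicator fun _ => c)
      (volume.restrict Ω) := fun ρ c =>
    (integrable_const c).indicator measurableSet_closedBall
  have hlower : 1 / 4 * (volume (Ω ∩ closedBall x₀ (r / 2))).toReal ≤ ∫ x in Ω, ‖u x‖ ^ 2 := by
    rw [← hconst]
    refine integral_mono (hconsti _ _) ?_ fun x => ?_
    · refine Integrable.of_bound (hK.continuous.norm.pow 2).aestronglyMeasurable 1
        (Filter.Eventually.of_forall fun x => ?_)
      rw [norm_pow, norm_norm, hnorm]
      exact pow_le_one₀ (tent_nonneg _ _ _) (tent_le_one _ _ hr)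
    · by_cases hx : x ∈ closedBall x₀ (r / 2)
      · have := half_le_tent hr (mem_closedBall.1 hx)
        rw [Set.indicator_of_mem hx, hnorm]
        nlinarith
      · rw [Set.indicator_of_notMem hx]
        positivity
  have hupper : (∫ x in Ω, ∑ i : Fin 2, ‖fderiv ℝ u x (EuclideanSpace.single i 1)
      - Complex.I * u x * (abPotential n p Φ x i : ℂ)‖ ^ 2)
      ≤ (1 / r) ^ 2 * (volume (Ω ∩ closedBall x₀ r)).toReal := by
    rw [← hconst]
    refine integral_mono_of_nonneg (Filter.Eventually.of_forall fun x => by positivity)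
      (hconsti _ _) (ae_restrict_of_ae ?_)
    filter_upwards [(lipschitzWith_tent x₀ hr).ae_differentiableAt] with x hx
    by_cases hxr : x ∈ closedBall x₀ r
    · have hx2 : x ∈ ball x₀ (2 * r) := mem_ball.2 (by linarith [mem_closedBall.1 hxr])
      rw [Set.indicator_of_mem hxr]
      calc _ = ∑ i : Fin 2, fderiv ℝ (tent x₀ r) x (EuclideanSpace.single i 1) ^ 2 := by
            refine Finset.sum_congr rfl fun i _ => ?_
            rw [← hgrad x hx2, hu,
              norm_fderiv_mul_exp_sub hx ((hθ x hx2).differentiableAt one_ne_zero), sq_abs]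
        _ ≤ ‖fderiv ℝ (tent x₀ r) x‖ ^ 2 := sum_sq_apply_single_le _
        _ ≤ (1 / r) ^ 2 := by
            gcongr
            have := norm_fderiv_le_of_lipschitz ℝ (lipschitzWith_tent x₀ hr) (x₀ := x)
            rwa [Real.coe_toNNReal _ (by positivity)] at this
    · have hev : u =ᶠ[nhds x] fun _ => 0 := by
        filter_upwards [isClosed_closedBall.isOpen_compl.mem_nhds hxr] with y hy
        have : r ≤ dist y x₀ := (not_le.1 fun h => hy (mem_closedBall.2 h)).le
        simp [hu, tent_eq_zero hr this]
      rw [Set.indicator_of_notMem hxr, hev.fderiv_eq, hev.eq_of_nhds]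
      simp
  have hfin' : ∀ ρ, volume (Ω ∩ closedBall x₀ ρ) ≠ ⊤ := fun ρ =>
    measure_ne_top_of_subset Set.inter_subset_left hfin
  have hdoub' : (volume (Ω ∩ closedBall x₀ r)).toReal
      < 9 * (volume (Ω ∩ closedBall x₀ (r / 2))).toReal := by
    have := (ENNReal.toReal_lt_toReal (hfin' r) (ENNReal.mul_ne_top (by simp) (hfin' _))).2 hdoub
    simpa using this
  have ha : 0 ≤ (volume (Ω ∩ closedBall x₀ r)).toReal := ENNReal.toReal_nonneg
  refine ⟨u, ⟨K, hK⟩, fun j => ⟨r, hr, fun x hx => ?_⟩, by linarith, hupper.trans ?_⟩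
  · have h1 := hfar j
    have h2 := dist_triangle x₀ x (p j)
    have h3 := mem_ball.1 hx
    rw [dist_comm x₀ x] at h2
    simp [hu, tent_eq_zero hr (show r ≤ dist x x₀ by linarith)]
  · have hinv : (1 / r) ^ 2 = 8 * Real.pi * (n / V) := by
      rw [div_pow, hr2]
      field_simp
    rw [hinv]
    have hc : 0 < Real.pi * (n / V) := by positivity
    nlinarith
end

section
/- Let Ω ⊂ ℝ² be a bounded open set with |Ω| > 0, let n ≥ 1, and let Γ_1, …, Γ_n ⊂ ℝ² be segments, where Γ_j has endpoints a_j, b_j, length h_j = d(a_j, b_j) with 0 < h_j < 1, and midpoint q_j; assume ∑_{j=1}^n h_j ≤ |Ω|/(2π). Then there exists a Lipschitz function u : ℝ² → ℝ with 0 ≤ u ≤ 1, vanishing on the union of the closed balls of center q_j and radius h_j (hence on a neighborhood of each Γ_j), such that ∫_Ω u² ≥ |Ω|/2 and ∫_Ω ‖Du(x)‖² dx ≤ 4π n ∑_{j=1}^n 1/|ln h_j|; in particular ∫_Ω ‖Du‖² ≤ (8π n/|Ω|) ∑_{j=1}^n (1/|ln h_j|) · ∫_Ω u². -/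
open MeasureTheory Metric

section LogCutoff

variable {E : Type*} [NormedAddCommGroup E]

/-- The logarithmic cutoff at `q`: it vanishes on the closed ball of radius `h`, equals `1` outside
the ball of radius `√h`, and is an affine function of `log ‖x - q‖` in between. -/
noncomputable def logCutoff (h : ℝ) (q x : E) : ℝ :=
  min 1 (2 / |Real.log h| * (Real.log (max ‖x - q‖ h) - Real.log h))

theorem logCutoff_le_one (h : ℝ) (q x : E) : logCutoff h q x ≤ 1 := min_le_left _ _

theorem logCutoff_nonneg {h : ℝ} (hpos : 0 < h) (q x : E) : 0 ≤ logCutoff h q x :=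
  le_min zero_le_one <| mul_nonneg (by positivity) <|
    sub_nonneg.2 (Real.log_le_log hpos (le_max_right _ _))

theorem logCutoff_eq_zero {h : ℝ} {q x : E} (hx : ‖x - q‖ ≤ h) : logCutoff h q x = 0 := by
  simp [logCutoff, max_eq_right hx]

theorem logCutoff_eq_one {h : ℝ} (hpos : 0 < h) (hlt : h < 1) {q x : E}
    (hx : √h ≤ ‖x - q‖) : logCutoff h q x = 1 := by
  have hlog : Real.log h < 0 := Real.log_neg hpos hlt
  have hle : Real.log h / 2 ≤ Real.log (max ‖x - q‖ h) := by
    rw [← Real.log_sqrt hpos.le]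
    exact Real.log_le_log (Real.sqrt_pos.2 hpos) (hx.trans (le_max_left _ _))
  refine min_eq_left ?_
  rw [abs_of_neg hlog, div_mul_eq_mul_div, le_div_iff₀ (by linarith)]
  linarith

theorem exists_lipschitzWith_logCutoff {h : ℝ} (hpos : 0 < h) (q : E) :
    ∃ K : NNReal, LipschitzWith K (logCutoff h q) := by
  refine ⟨_, LipschitzWith.const_min (LipschitzWith.of_le_add_mul'
    (2 / |Real.log h| * (1 / h)) fun x y => ?_) 1⟩
  have hx : 0 < max ‖x - q‖ h := lt_max_of_lt_right hpos
  have hy : 0 < max ‖y - q‖ h := lt_max_of_lt_right hpos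
  have hdist : max ‖x - q‖ h - max ‖y - q‖ h ≤ dist x y := by
    have hxy : ‖x - q‖ ≤ dist x y + ‖y - q‖ := by
      simpa only [dist_eq_norm] using dist_triangle x y q
    have hyl := le_max_left ‖y - q‖ h
    have hyr := le_max_right ‖y - q‖ h
    have := dist_nonneg (x := x) (y := y)
    rw [sub_le_iff_le_add]
    exact max_le (by linarith) (by linarith)
  have hlog : Real.log (max ‖x - q‖ h) - Real.log (max ‖y - q‖ h) ≤ 1 / h * dist x y := by
    rw [← Real.log_div hx.ne' hy.ne']
    calc Real.log (max ‖x - q‖ h / max ‖y - q‖ h)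
        ≤ max ‖x - q‖ h / max ‖y - q‖ h - 1 := Real.log_le_sub_one_of_pos (by positivity)
      _ = (max ‖x - q‖ h - max ‖y - q‖ h) / max ‖y - q‖ h := by field_simp
      _ ≤ dist x y / max ‖y - q‖ h := by gcongr
      _ ≤ dist x y / h := by gcongr; exact le_max_right _ _
      _ = 1 / h * dist x y := by ring
  have := mul_le_mul_of_nonneg_left hlog (show 0 ≤ 2 / |Real.log h| by positivity)
  linarith

theorem norm_mem_Ioo_of_logCutoff {h : ℝ} (hpos : 0 < h) (hlt : h < 1) {q x : E}
    (h0 : 0 < logCutoff h q x) (h1 : logCutoff h q x < 1) : ‖x - q‖ ∈ Set.Ioo h (√h) := by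
  constructor
  · by_contra! hx
    exact h0.ne' (logCutoff_eq_zero hx)
  · by_contra! hx
    exact h1.ne (logCutoff_eq_one hpos hlt hx)

end LogCutoff

/-- The squared length of the gradient of `logCutoff h q`, as a function of `‖x - q‖`. -/
noncomputable def logCutoffEnergy (h : ℝ) : ℝ → ℝ :=
  (Set.Ioo h (√h)).indicator fun r => (2 / |Real.log h| / r) ^ 2

theorem logCutoffEnergy_nonneg (h r : ℝ) : 0 ≤ logCutoffEnergy h r :=
  Set.indicator_nonneg (fun _ _ => by positivity) r

theorem exists_hasFDerivAt_logCutoff {E : Type*} [NormedAddCommGroup E] [InnerProductSpace ℝ E]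
    {h : ℝ} (hpos : 0 < h) (hlt : h < 1) {q x : E}
    (h0 : 0 < logCutoff h q x) (h1 : logCutoff h q x < 1) :
    ∃ L : E →L[ℝ] ℝ, HasFDerivAt (logCutoff h q) L x ∧ ‖L‖ ^ 2 ≤ logCutoffEnergy h ‖x - q‖ := by
  have hx := norm_mem_Ioo_of_logCutoff hpos hlt h0 h1
  have hxpos : 0 < ‖x - q‖ := hpos.trans hx.1
  have hnorm : DifferentiableAt ℝ (fun y : E => ‖y - q‖) x :=
    (differentiableAt_id.sub_const q).norm ℝ (norm_pos_iff.1 hxpos)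
  have hnorm_le : ‖fderiv ℝ (fun y : E => ‖y - q‖) x‖ ≤ 1 := by
    have hlip : LipschitzWith 1 (fun y : E => ‖y - q‖) := by
      simpa only [dist_eq_norm] using LipschitzWith.dist_left q
    simpa using norm_fderiv_le_of_lipschitz ℝ hlip (x₀ := x)
  have hder := ((hnorm.hasFDerivAt.log hxpos.ne').sub_const (Real.log h)).const_mul
    (2 / |Real.log h|)
  refine ⟨_, hder.congr_of_eventuallyEq ?_, ?_⟩
  · have hcont : Continuous (logCutoff h q) :=
      (exists_lipschitzWith_logCutoff hpos q).choose_spec.continuous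
    filter_upwards [hcont.continuousAt.eventually_lt continuousAt_const h1,
      hnorm.continuousAt.eventually_const_lt hx.1] with y hy1 hyh
    have hmin := (min_lt_iff.1 hy1).resolve_left (lt_irrefl 1)
    rw [logCutoff, min_eq_right hmin.le, max_eq_left hyh.le]
  · rw [logCutoffEnergy, Set.indicator_of_mem hx]
    gcongr
    rw [norm_smul, norm_smul, norm_inv, norm_norm, Real.norm_of_nonneg (by positivity),
      div_eq_mul_inv _ ‖x - q‖]
    gcongr
    exact mul_le_of_le_one_right (by positivity) hnorm_le

theorem pow_smul_logCutoffEnergy (h : ℝ) :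
    (fun r : ℝ => r ^ (2 - 1) • logCutoffEnergy h r) =
      (Set.Ioo h (√h)).indicator fun r => (2 / |Real.log h|) ^ 2 * r⁻¹ := by
  ext r
  by_cases hr : r ∈ Set.Ioo h (√h)
  · simp only [logCutoffEnergy, Set.indicator_of_mem hr, smul_eq_mul]
    rcases eq_or_ne r 0 with rfl | hr0
    · simp
    · rw [show 2 - 1 = 1 from rfl, pow_one]
      field_simp
  · simp [logCutoffEnergy, Set.indicator_of_notMem hr]

theorem le_sqrt_self {h : ℝ} (hpos : 0 < h) (hlt : h < 1) : h ≤ √h :=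
  Real.le_sqrt_of_sq_le (by nlinarith)

theorem integrable_logCutoffEnergy {h : ℝ} (hpos : 0 < h)
    (q : EuclideanSpace ℝ (Fin 2)) : Integrable (fun x => logCutoffEnergy h ‖x - q‖) := by
  refine Integrable.comp_sub_right (f := fun x => logCutoffEnergy h ‖x‖) ?_ q
  rw [integrable_fun_norm_addHaar, finrank_euclideanSpace_fin, pow_smul_logCutoffEnergy]
  refine Integrable.integrableOn ((integrable_indicator_iff measurableSet_Ioo).2 ?_)
  refine Integrable.const_mul (IntegrableOn.mono_set ?_ Set.Ioo_subset_Icc_self) _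
  refine (continuousOn_id.inv₀ fun r hr => ?_).integrableOn_Icc
  exact (hpos.trans_le hr.1).ne'

theorem integral_logCutoffEnergy {h : ℝ} (hpos : 0 < h) (hlt : h < 1)
    (q : EuclideanSpace ℝ (Fin 2)) :
    ∫ x, logCutoffEnergy h ‖x - q‖ = 4 * Real.pi * (1 / |Real.log h|) := by
  have hsub : Set.Ioo h (√h) ⊆ Set.Ioi 0 := fun r hr => hpos.trans hr.1
  have hlog : Real.log h < 0 := Real.log_neg hpos hlt
  rw [integral_sub_right_eq_self (fun x => logCutoffEnergy h ‖x‖) q, integral_fun_norm_addHaar,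
    finrank_euclideanSpace_fin, pow_smul_logCutoffEnergy, setIntegral_indicator measurableSet_Ioo,
    Set.inter_eq_right.2 hsub, integral_const_mul, ← integral_Ioc_eq_integral_Ioo,
    ← intervalIntegral.integral_of_le (le_sqrt_self hpos hlt),
    integral_inv_of_pos hpos (Real.sqrt_pos.2 hpos),
    Real.log_div (Real.sqrt_pos.2 hpos).ne' hpos.ne', Real.log_sqrt hpos.le, measureReal_def,
    EuclideanSpace.volume_ball_fin_two]
  rw [abs_of_neg hlog]
  simp [Real.pi_pos.le]
  field_simp
  ring

/-- A differentiable minimum of finitely many functions has, at each point, the derivative of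
any of them which is active and differentiable there. -/
theorem fderiv_inf'_eq {E ι : Type*} [NormedAddCommGroup E] [NormedSpace ℝ E] {s : Finset ι}
    (hs : s.Nonempty) {f : ι → E → ℝ} {x : E} {L : E →L[ℝ] ℝ} {j : ι} (hj : j ∈ s)
    (hact : s.inf' hs (fun i => f i x) = f j x) (hf : HasFDerivAt (f j) L x)
    (hd : DifferentiableAt ℝ (fun y => s.inf' hs fun i => f i y) x) :
    fderiv ℝ (fun y => s.inf' hs fun i => f i y) x = L := by
  have hmin : IsLocalMin (fun y => f j y - s.inf' hs fun i => f i y) x := by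
    refine Filter.Eventually.of_forall fun y => ?_
    simp only [hact, sub_self, sub_nonneg]
    exact Finset.inf'_le _ hj
  exact (sub_eq_zero.1 (hmin.hasFDerivAt_eq_zero (hf.sub hd.hasFDerivAt))).symm

theorem exists_lipschitzWith_inf' {E ι : Type*} [PseudoMetricSpace E] {s : Finset ι}
    (hs : s.Nonempty) {f : ι → E → ℝ} (hf : ∀ i ∈ s, ∃ K : NNReal, LipschitzWith K (f i)) :
    ∃ K : NNReal, LipschitzWith K (fun y => s.inf' hs fun i => f i y) := by
  choose! K hK using hf
  refine ⟨s.sup K, LipschitzWith.of_le_add_mul _ fun x y => ?_⟩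
  obtain ⟨j, hj, hact⟩ := Finset.exists_mem_eq_inf' hs fun i => f i y
  calc s.inf' hs (fun i => f i x) ≤ f j x := Finset.inf'_le _ hj
    _ ≤ f j y + s.sup K * dist x y :=
      ((hK j hj).weaken (Finset.le_sup hj)).le_add_mul x y
    _ = _ := by rw [hact]

section LogCutoffInf

variable {E ι : Type*} [NormedAddCommGroup E] [InnerProductSpace ℝ E]

theorem sq_norm_fderiv_inf'_logCutoff_le {s : Finset ι} (hs : s.Nonempty) {h : ι → ℝ}
    (hpos : ∀ j, 0 < h j) (hlt : ∀ j, h j < 1) (q : ι → E) (x : E) :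
    ‖fderiv ℝ (fun y => s.inf' hs fun j => logCutoff (h j) (q j) y) x‖ ^ 2 ≤
      ∑ j ∈ s, logCutoffEnergy (h j) ‖x - q j‖ := by
  set u : E → ℝ := fun y => s.inf' hs fun j => logCutoff (h j) (q j) y with hu
  have hsum : 0 ≤ ∑ j ∈ s, logCutoffEnergy (h j) ‖x - q j‖ :=
    Finset.sum_nonneg fun j _ => logCutoffEnergy_nonneg _ _
  by_cases hzero : fderiv ℝ u x = 0
  · simpa [hzero] using hsum
  have hd : DifferentiableAt ℝ u x := by
    by_contra hd
    exact hzero (fderiv_zero_of_not_differentiableAt hd)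
  obtain ⟨j, hj, hact⟩ := Finset.exists_mem_eq_inf' hs fun j => logCutoff (h j) (q j) x
  have hu_nonneg : ∀ y, 0 ≤ u y := fun y =>
    (Finset.le_inf'_iff hs _).2 fun i _ => logCutoff_nonneg (hpos i) _ _
  have hu_le : ∀ y, u y ≤ 1 := fun y => (Finset.inf'_le _ hj).trans (logCutoff_le_one _ _ _)
  have hu0 : 0 < u x := (hu_nonneg x).lt_of_ne' fun h0 => hzero <|
    IsLocalMin.fderiv_eq_zero <| Filter.Eventually.of_forall fun y => h0.trans_le (hu_nonneg y)
  have hu1 : u x < 1 := (hu_le x).lt_of_ne fun h1 => hzero <|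
    IsLocalMax.fderiv_eq_zero <| Filter.Eventually.of_forall fun y => (hu_le y).trans_eq h1.symm
  obtain ⟨L, hL, hbound⟩ := exists_hasFDerivAt_logCutoff (hpos j) (hlt j)
    (hu0.trans_eq hact) (hact.symm.trans_lt hu1)
  rw [hu, fderiv_inf'_eq hs hj hact hL hd]
  exact hbound.trans (Finset.single_le_sum (f := fun j => logCutoffEnergy (h j) ‖x - q j‖)
    (fun j _ => logCutoffEnergy_nonneg _ _) hj)

end LogCutoffInf

/-- Removing finitely many disks of total area at most half of a set leaves half of its area. -/
theorem half_volume_le_measureReal_diff_iUnion_ball {ι : Type*} [Fintype ι]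
    {Ω : Set (EuclideanSpace ℝ (Fin 2))} (q : ι → EuclideanSpace ℝ (Fin 2))
    {h : ι → ℝ} (hpos : ∀ j, 0 < h j)
    (hsum : ∑ j, h j ≤ (volume Ω).toReal / (2 * Real.pi)) :
    (volume Ω).toReal / 2 ≤ volume.real (Ω \ ⋃ j, ball (q j) (√(h j))) := by
  have hball : ∀ j, volume.real (ball (q j) (√(h j))) = Real.pi * h j := fun j => by
    rw [measureReal_def, EuclideanSpace.volume_ball_fin_two, ← ENNReal.ofReal_pow (by positivity),
      Real.sq_sqrt (hpos j).le, ENNReal.toReal_mul, ENNReal.toReal_ofReal (hpos j).le,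
      ENNReal.toReal_ofReal Real.pi_pos.le, mul_comm]
  have hunion : volume.real (⋃ j, ball (q j) (√(h j))) ≤ (volume Ω).toReal / 2 :=
    calc volume.real (⋃ j, ball (q j) (√(h j)))
        ≤ ∑ j, volume.real (ball (q j) (√(h j))) := measureReal_iUnion_fintype_le _
      _ = Real.pi * ∑ j, h j := by simp only [hball, Finset.mul_sum]
      _ ≤ Real.pi * ((volume Ω).toReal / (2 * Real.pi)) := by gcongr
      _ = (volume Ω).toReal / 2 := by field_simp
  have hunion_fin : volume (⋃ j, ball (q j) (√(h j))) ≠ ⊤ :=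
    ((measure_iUnion_fintype_le _ _).trans_lt
      (ENNReal.sum_lt_top.2 fun j _ => measure_ball_lt_top)).ne
  have hdiff := le_measureReal_sdiff (μ := volume) (s₁ := Ω) (s₂ := ⋃ j, ball (q j) (√(h j)))
    hunion_fin
  rw [measureReal_def (s := Ω)] at hdiff
  linarith

/-- Theorem 2.6 (analytic content): given a bounded open `Ω ⊂ ℝ²` of positive area and `n ≥ 1`
segments `Γ j` with endpoints `a j, b j`, lengths `h j = d(a j, b j) ∈ (0,1)` and midpoints
`q j`, with `∑ⱼ h j ≤ |Ω|/(2π)`, there is a Lipschitz function `u : ℝ² → ℝ`, `0 ≤ u ≤ 1`,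
vanishing on each closed ball `B̄(q j, h j)` (hence on a neighborhood of each `Γ j`), with
`∫_Ω u² ≥ |Ω|/2` and `∫_Ω ‖Du‖² ≤ 4πn ∑ⱼ 1/|ln h j|`; in particular
`∫_Ω ‖Du‖² ≤ (8πn/|Ω|) ∑ⱼ (1/|ln h j|) ∫_Ω u²`. -/
theorem stmt_6 (Ω : Set (EuclideanSpace ℝ (Fin 2))) (hΩ : IsOpen Ω)
    (hbd : Bornology.IsBounded Ω) (h0 : 0 < volume Ω) (n : ℕ) (hn : 1 ≤ n)
    (a b : Fin n → EuclideanSpace ℝ (Fin 2)) (h : Fin n → ℝ)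
    (hlen : ∀ j, h j = dist (a j) (b j)) (hpos : ∀ j, 0 < h j) (hlt1 : ∀ j, h j < 1)
    (hsum : ∑ j, h j ≤ (volume Ω).toReal / (2 * Real.pi)) :
    ∃ u : EuclideanSpace ℝ (Fin 2) → ℝ,
      (∃ K : NNReal, LipschitzWith K u) ∧
      (∀ x, u x ∈ Set.Icc (0 : ℝ) 1) ∧
      (∀ j, ∀ x ∈ Metric.closedBall (midpoint ℝ (a j) (b j)) (h j), u x = 0) ∧
      ((volume Ω).toReal / 2 ≤ ∫ x in Ω, (u x) ^ 2) ∧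
      ((∫ x in Ω, ‖fderiv ℝ u x‖ ^ 2)
          ≤ 4 * Real.pi * n * ∑ j, 1 / |Real.log (h j)|) ∧
      (∫ x in Ω, ‖fderiv ℝ u x‖ ^ 2)
          ≤ (8 * Real.pi * n / (volume Ω).toReal) * (∑ j, 1 / |Real.log (h j)|)
            * ∫ x in Ω, (u x) ^ 2 := by
  have hs : (Finset.univ : Finset (Fin n)).Nonempty := ⟨⟨0, hn⟩, Finset.mem_univ _⟩
  have hfin : volume Ω ≠ ⊤ := hbd.measure_lt_top.ne
  have hvol : 0 < (volume Ω).toReal := ENNReal.toReal_pos h0.ne' hfin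
  set q : Fin n → EuclideanSpace ℝ (Fin 2) := fun j => midpoint ℝ (a j) (b j) with hq
  set u : EuclideanSpace ℝ (Fin 2) → ℝ :=
    fun y => Finset.univ.inf' hs fun j => logCutoff (h j) (q j) y with hu
  have hlip : ∃ K : NNReal, LipschitzWith K u :=
    exists_lipschitzWith_inf' hs fun j _ => exists_lipschitzWith_logCutoff (hpos j) (q j)
  have hu_mem : ∀ x, u x ∈ Set.Icc (0 : ℝ) 1 := fun x =>
    ⟨(Finset.le_inf'_iff hs _).2 fun j _ => logCutoff_nonneg (hpos j) _ _,
      (Finset.inf'_le _ hs.choose_spec).trans (logCutoff_le_one _ _ _)⟩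
  have hmass : (volume Ω).toReal / 2 ≤ ∫ x in Ω, (u x) ^ 2 := by
    have hmeas : MeasurableSet (Ω \ ⋃ j, ball (q j) (√(h j))) :=
      hΩ.measurableSet.diff (isOpen_iUnion fun j => isOpen_ball).measurableSet
    have hint : IntegrableOn (fun x => (u x) ^ 2) Ω := by
      refine Measure.integrableOn_of_bounded hfin
        (hlip.choose_spec.continuous.pow 2).aestronglyMeasurable (M := 1) ?_
      refine Filter.Eventually.of_forall fun x => ?_
      rw [Real.norm_of_nonneg (by positivity)]
      exact pow_le_one₀ (hu_mem x).1 (hu_mem x).2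
    calc (volume Ω).toReal / 2 ≤ volume.real (Ω \ ⋃ j, ball (q j) (√(h j))) :=
          half_volume_le_measureReal_diff_iUnion_ball q hpos hsum
      _ = ∫ x in Ω \ ⋃ j, ball (q j) (√(h j)), (u x) ^ 2 := by
          rw [setIntegral_congr_fun (g := fun _ => (1 : ℝ)) hmeas, setIntegral_const, smul_eq_mul,
            mul_one]
          intro x hx
          have hone : ∀ j, logCutoff (h j) (q j) x = 1 := fun j => by
            refine logCutoff_eq_one (hpos j) (hlt1 j) ?_
            by_contra! hlt
            exact hx.2 (Set.mem_iUnion.2 ⟨j, mem_ball_iff_norm.2 hlt⟩)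
          simp [hu, hone]
      _ ≤ ∫ x in Ω, (u x) ^ 2 :=
          setIntegral_mono_set hint (Filter.Eventually.of_forall fun x => sq_nonneg _)
            Set.sdiff_subset.eventuallyLE
  have hsum_nonneg : 0 ≤ ∑ j, 1 / |Real.log (h j)| := Finset.sum_nonneg fun j _ => by positivity
  have henergy : ∫ x in Ω, ‖fderiv ℝ u x‖ ^ 2 ≤
      4 * Real.pi * n * ∑ j, 1 / |Real.log (h j)| := by
    have hint : ∀ j, Integrable fun x => logCutoffEnergy (h j) ‖x - q j‖ := fun j =>
      integrable_logCutoffEnergy (hpos j) (q j)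
    have hint_sum := integrable_finsetSum Finset.univ fun j _ => hint j
    calc ∫ x in Ω, ‖fderiv ℝ u x‖ ^ 2
        ≤ ∫ x in Ω, ∑ j, logCutoffEnergy (h j) ‖x - q j‖ :=
          integral_mono_of_nonneg (Filter.Eventually.of_forall fun x => sq_nonneg _)
            hint_sum.integrableOn (Filter.Eventually.of_forall fun x =>
              sq_norm_fderiv_inf'_logCutoff_le hs hpos hlt1 q x)
      _ ≤ ∫ x, ∑ j, logCutoffEnergy (h j) ‖x - q j‖ :=
          setIntegral_le_integral hint_sum (Filter.Eventually.of_forall fun x =>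
            Finset.sum_nonneg fun j _ => logCutoffEnergy_nonneg _ _)
      _ = 4 * Real.pi * ∑ j, 1 / |Real.log (h j)| := by
          rw [integral_finsetSum _ fun j _ => hint j, Finset.mul_sum]
          exact Finset.sum_congr rfl fun j _ => integral_logCutoffEnergy (hpos j) (hlt1 j) (q j)
      _ ≤ 4 * Real.pi * n * ∑ j, 1 / |Real.log (h j)| := by
          refine mul_le_mul_of_nonneg_right ?_ hsum_nonneg
          exact le_mul_of_one_le_right (by positivity) (by exact_mod_cast hn)
  refine ⟨u, hlip, hu_mem, fun j x hx => ?_, hmass, henergy, henergy.trans ?_⟩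
  · refine le_antisymm ?_ (hu_mem x).1
    refine (Finset.inf'_le _ (Finset.mem_univ j)).trans_eq (logCutoff_eq_zero ?_)
    exact mem_closedBall_iff_norm.1 hx
  · calc 4 * Real.pi * n * ∑ j, 1 / |Real.log (h j)|
        = (8 * Real.pi * n / (volume Ω).toReal) * (∑ j, 1 / |Real.log (h j)|)
            * ((volume Ω).toReal / 2) := by field_simp; ring
      _ ≤ _ := by gcongr
end

section
/- Let n ≥ 1 and let h_1, …, h_n be real numbers with 0 < h_j ≤ e^{−2} for every j. Then ∑_{j=1}^n 1/|ln h_j| ≤ n / |ln((h_1 + ⋯ + h_n)/n)|. -/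
/-- The function `x ↦ -1 / log x` is concave on `(0, e⁻²]`. -/
theorem concaveOn_neg_inv_log :
    ConcaveOn ℝ (Set.Ioc 0 (Real.exp (-2))) fun x ↦ -(Real.log x)⁻¹ := by
  have hlog : ∀ x ∈ Set.Ioc 0 (Real.exp (-2)), Real.log x ≤ -2 := fun x hx ↦
    (Real.log_le_iff_le_exp hx.1).2 hx.2
  have hderiv : ∀ x ∈ Set.Ioc 0 (Real.exp (-2)),
      HasDerivAt (fun x ↦ -(Real.log x)⁻¹) (x * Real.log x ^ 2)⁻¹ x := by
    intro x hx
    have hL : Real.log x ≠ 0 := by linarith [hlog x hx]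
    have hx0 : x ≠ 0 := hx.1.ne'
    refine ((Real.hasDerivAt_log hx0).fun_inv hL).fun_neg.congr_deriv ?_
    field_simp
  refine concaveOn_of_hasDerivWithinAt2_nonpos (convex_Ioc _ _)
    (f' := fun x ↦ (x * Real.log x ^ 2)⁻¹)
    (f'' := fun x ↦ -(Real.log x ^ 2 + 2 * Real.log x) / (x * Real.log x ^ 2) ^ 2)
    (fun x hx ↦ (hderiv x hx).continuousAt.continuousWithinAt)
    (fun x hx ↦ (hderiv x (interior_subset hx)).hasDerivWithinAt) ?_ ?_
  · intro x hx
    have hx := interior_subset hx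
    have hL : Real.log x ≠ 0 := by linarith [hlog x hx]
    have hx0 : x ≠ 0 := hx.1.ne'
    refine HasDerivAt.hasDerivWithinAt ?_
    refine (((hasDerivAt_id' x).fun_mul ((Real.hasDerivAt_log hx0).fun_pow 2)).fun_inv
      (mul_ne_zero hx0 (pow_ne_zero 2 hL))).congr_deriv ?_
    field_simp
    ring
  · intro x hx
    have := hlog x (interior_subset hx)
    exact div_nonpos_of_nonpos_of_nonneg (by nlinarith) (sq_nonneg _)

/-- Jensen-type inequality: if `0 < h j ≤ e⁻²` for `j = 1, …, n` (`n ≥ 1`), then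
`∑ⱼ 1/|ln (h j)| ≤ n / |ln((h 1 + ⋯ + h n)/n)|`. -/
theorem stmt_11 (n : ℕ) (hn : 1 ≤ n) (h : Fin n → ℝ)
    (hpos : ∀ j, 0 < h j) (hle : ∀ j, h j ≤ Real.exp (-2)) :
    ∑ j, 1 / |Real.log (h j)| ≤ (n : ℝ) / |Real.log ((∑ j, h j) / n)| := by
  have hn0 : (0 : ℝ) < n := by exact_mod_cast hn
  have hw : ∑ _j : Fin n, (n : ℝ)⁻¹ = 1 := by simp [hn0.ne']
  have hmem : ∀ j ∈ Finset.univ, h j ∈ Set.Ioc 0 (Real.exp (-2)) := fun j _ ↦ ⟨hpos j, hle j⟩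
  have habs : ∀ x ∈ Set.Ioc 0 (Real.exp (-2)), |Real.log x|⁻¹ = -(Real.log x)⁻¹ := by
    intro x hx
    have := (Real.log_le_iff_le_exp hx.1).2 hx.2
    rw [abs_of_neg (by linarith), inv_neg]
  have hmean := concaveOn_neg_inv_log.1.sum_mem (fun _ _ ↦ (inv_pos.2 hn0).le) hw hmem
  have hjensen := concaveOn_neg_inv_log.le_map_sum (fun _ _ ↦ (inv_pos.2 hn0).le) hw hmem
  rw [← habs _ hmean] at hjensen
  simp only [smul_eq_mul, ← Finset.mul_sum] at hjensen
  rw [inv_mul_le_iff₀ hn0, inv_mul_eq_div] at hjensen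
  rw [div_eq_mul_inv (n : ℝ)]
  refine (Finset.sum_congr rfl fun j hj ↦ ?_).trans_le hjensen
  rw [one_div, habs _ (hmem j hj)]
end
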